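/- arXiv:1703.06714 — 2 statements merged into one kernel-verified Lean document; each statement's English description precedes it below -/
import Mathlib

section
/- Sum-rate identity of Theorem 2 (eq. (35)) in combinatorial form: let F be a field, A an invertible L×L matrix over F, 𝓛_1,…,𝓛_N column index sets, and r_1,…,r_N ≥ 0 reals. Let π be a permutation of {1,…,L}, write Π(Ī_m) := {π(m+1),…,π(L)}, and define J_m := { k : rank A(Π(Ī_{m−1}), 𝓛_k) = rank A(Π(Ī_m), 𝓛_k) + 1 }. Then Σ_{m=1}^{L} Σ_{k ∈ J_m} r_k = Σ_{l=1}^{L} Σ_{k : l ∈ 𝓛_k} r_k, i.e., the sum of the compression rates R_{π(m)} = Σ_{k∈J_m} r_k equals the sum of the source rates r_l = Σ_{k : l∈𝓛_k} r_k. -/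
/-- The rank of the submatrix of `A` with rows indexed by `S` and columns indexed by `C`. -/
noncomputable def subRank {F : Type*} [Field F] {m n : Type*} [Fintype n]
    (A : Matrix m n F) (S : Finset m) (C : Finset n) : ℕ :=
  (A.submatrix (fun i : S => (i : m)) (fun j : C => (j : n))).rank

/-- The row-space dimension formula for `subRank`. -/
theorem subRank_eq_finrank_span_rows {F : Type*} [Field F] {m n : Type*} [Fintype n]
    (A : Matrix m n F) (S : Finset m) (C : Finset n) :
    subRank A S C =
      Module.finrank F (Submodule.span F ((fun (i : m) (j : C) => A i j) '' (S : Set m))) := by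
  rw [subRank, Matrix.rank_eq_finrank_span_row, Set.image_eq_range]
  rfl

/-- Adding a row does not decrease the rank. -/
theorem subRank_le_subRank_insert {F : Type*} [Field F] {m n : Type*} [Fintype n]
    [DecidableEq m] (A : Matrix m n F) (i : m) (S : Finset m) (C : Finset n) :
    subRank A S C ≤ subRank A (insert i S) C := by
  simp only [subRank_eq_finrank_span_rows]
  refine Submodule.finrank_mono (Submodule.span_mono (Set.image_mono ?_))
  exact_mod_cast Finset.subset_insert i S

/-- Adding a row increases the rank by at most one. -/
theorem subRank_insert_le {F : Type*} [Field F] {m n : Type*} [Fintype n]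
    [DecidableEq m] (A : Matrix m n F) (i : m) (S : Finset m) (C : Finset n) :
    subRank A (insert i S) C ≤ subRank A S C + 1 := by
  simp only [subRank_eq_finrank_span_rows]
  rw [Finset.coe_insert, Set.image_insert_eq, Submodule.span_insert, add_comm]
  refine (Submodule.finrank_add_le_finrank_add_finrank _ _).trans ?_
  gcongr
  simpa using finrank_span_le_card (R := F) ({fun j : C => A i j} : Set (C → F))

theorem subRank_empty {F : Type*} [Field F] {m n : Type*} [Fintype n]
    (A : Matrix m n F) (C : Finset n) : subRank A ∅ C = 0 := by
  simp [subRank_eq_finrank_span_rows]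

/-- The columns of an invertible matrix are independent. -/
theorem subRank_univ_of_isUnit {F : Type*} [Field F] {n : Type*} [Fintype n] [DecidableEq n]
    {A : Matrix n n F} (hA : IsUnit A) (C : Finset n) :
    subRank A Finset.univ C = C.card := by
  have h : LinearIndependent F (A.submatrix id (fun j : C => (j : n))).transpose.row :=
    (Matrix.linearIndependent_cols_of_isUnit hA).comp (fun j : C => (j : n))
      Subtype.val_injective
  rw [subRank_eq_finrank_span_rows, Finset.coe_univ, Set.image_univ]
  have hrank := h.rank_matrix
  rw [Matrix.rank_transpose, Matrix.rank_eq_finrank_span_row, Fintype.card_coe] at hrank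
  exact hrank

/-- The number of unit jumps of a sequence with decrements in `{0, 1}` is its total decrease. -/
theorem card_unit_jumps (f : ℕ → ℕ) (L : ℕ) (hL : f L = 0)
    (hmono : ∀ i < L, f (i + 1) ≤ f i) (hstep : ∀ i < L, f i ≤ f (i + 1) + 1) :
    (Finset.univ.filter (fun m : Fin L => f m = f (m + 1) + 1)).card = f 0 := by
  rw [Finset.card_filter,
    Fin.sum_univ_eq_sum_range (fun m => if f m = f (m + 1) + 1 then 1 else 0), ← Nat.cast_inj (R := ℤ)]
  simp only [Nat.cast_sum, Nat.cast_ite, Nat.cast_one, Nat.cast_zero]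
  have h := Finset.sum_range_sub' (fun i => (f i : ℤ)) L
  rw [hL, Nat.cast_zero, sub_zero] at h
  rw [← h]
  refine Finset.sum_congr rfl fun i hi => ?_
  have h₁ := hmono i (Finset.mem_range.1 hi)
  have h₂ := hstep i (Finset.mem_range.1 hi)
  split_ifs <;> omega

/-- For an invertible matrix, the number of rank jumps along the tails of a row ordering is the
number of selected columns. -/
theorem card_subRank_jumps {F : Type*} [Field F] {L : ℕ} {A : Matrix (Fin L) (Fin L) F}
    (hA : IsUnit A) (π : Equiv.Perm (Fin L)) (C : Finset (Fin L)) :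
    (Finset.univ.filter (fun m : Fin L =>
      subRank A ((Finset.Ici m).image π) C =
        subRank A ((Finset.Ioi m).image π) C + 1)).card = C.card := by
  let T : ℕ → Finset (Fin L) := fun i => Finset.univ.filter (fun x : Fin L => i ≤ x)
  have hIci (m : Fin L) : Finset.Ici m = T m := by
    ext x; simp [T]
  have hIoi (m : Fin L) : Finset.Ioi m = T (m + 1) := by
    ext x; simp [T]
  have hT (i : ℕ) (hi : i < L) :
      (T i).image π = insert (π ⟨i, hi⟩) ((T (i + 1)).image π) := by
    rw [← Finset.image_insert]
    congr 1
    ext x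
    simp only [T, Finset.mem_filter, Finset.mem_univ, true_and, Finset.mem_insert, Fin.ext_iff]
    omega
  have hzero : (T 0).image π = Finset.univ := by
    simp [T]
  have hlast : T L = ∅ := by
    ext x; simp [T]
  simp only [hIci, hIoi]
  rw [card_unit_jumps (fun i => subRank A ((T i).image π) C) L, hzero, subRank_univ_of_isUnit hA]
  · rw [hlast, Finset.image_empty, subRank_empty]
  · intro i hi
    rw [hT i hi]
    exact subRank_le_subRank_insert A _ _ C
  · intro i hi
    rw [hT i hi]
    exact subRank_insert_le A _ _ C

/-- **Sum-rate identity of Theorem 2** (eq. (35) of the paper) in combinatorial form: for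
an invertible `L×L` matrix `A`, a permutation `π` of the rows, and
`J_m := {k : rank A({π(m),…,π(L)}, 𝓛_k) = rank A({π(m+1),…,π(L)}, 𝓛_k) + 1}`, the total
compression rate equals the total source rate:
`Σ_{m=1}^{L} Σ_{k∈J_m} r_k = Σ_{l=1}^{L} Σ_{k : l∈𝓛_k} r_k`. -/
theorem sum_rate_identity
    {F : Type*} [Field F] {L N : ℕ} (A : Matrix (Fin L) (Fin L) F) (hA : IsUnit A)
    (𝓛 : Fin N → Finset (Fin L)) (r : Fin N → ℝ) (hr : ∀ k, 0 ≤ r k)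
    (π : Equiv.Perm (Fin L))
    (J : Fin L → Finset (Fin N))
    (hJ : ∀ m : Fin L, J m = Finset.univ.filter (fun k =>
      subRank A ((Finset.Ici m).image π) (𝓛 k) =
        subRank A ((Finset.Ioi m).image π) (𝓛 k) + 1)) :
    ∑ m : Fin L, ∑ k ∈ J m, r k =
      ∑ l : Fin L, ∑ k ∈ Finset.univ.filter (fun k => l ∈ 𝓛 k), r k := by
  simp only [hJ, Finset.sum_filter]
  rw [Finset.sum_comm]
  conv_rhs => rw [Finset.sum_comm]
  refine Finset.sum_congr rfl fun k _ => ?_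
  rw [← Finset.sum_filter, ← Finset.sum_filter, Finset.sum_const, Finset.sum_const,
    card_subRank_jumps hA, Finset.filter_univ_mem]
end

section
/- Interval structure of the compression index set under the separability condition (Theorem 3's combinatorial content): let F be a field, A an invertible L×L matrix over F, and 𝓛_1,…,𝓛_{2L−1} column index sets that are unimodally nested around index L: 𝓛_L = {1,…,L}, 𝓛_k ⊆ 𝓛_{k+1} for k < L, and 𝓛_{k+1} ⊆ 𝓛_k for k ≥ L. Fix a row set S and a row index a ∉ S, and define J := { k : rank A(S ∪ {a}, 𝓛_k) = rank A(S, 𝓛_k) + 1 }. Then L ∈ J, and J is an interval of integers: whenever k ∈ J and k < k' ≤ L then k' ∈ J, and whenever k ∈ J and L ≤ k' < k then k' ∈ J; hence J = {min J, min J + 1, …, max J}. -/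
/-- The rank of a submatrix is the dimension of the span of the restricted rows. -/
theorem subRank_eq_finrank_span {F m n : Type*} [Field F] [Fintype n]
    (A : Matrix m n F) (S : Finset m) (C : Finset n) :
    subRank A S C =
      Module.finrank F (Submodule.span F ((fun i => C.restrict (A i)) '' (S : Set m))) := by
  rw [subRank, Matrix.rank_eq_finrank_span_row, Set.image_eq_range]
  rfl

/-- Adding a row raises the rank by one exactly when the restricted row is not spanned by the
restricted rows already present. -/
theorem subRank_insert_eq_add_one_iff {F m n : Type*} [Field F] [Fintype n] [DecidableEq m]
    (A : Matrix m n F) (S : Finset m) (a : m) (C : Finset n) :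
    subRank A (insert a S) C = subRank A S C + 1 ↔
      C.restrict (A a) ∉ Submodule.span F ((fun i => C.restrict (A i)) '' (S : Set m)) := by
  rw [subRank_eq_finrank_span, subRank_eq_finrank_span, Finset.coe_insert, Set.image_insert_eq]
  constructor
  · intro h hmem
    rw [Submodule.span_insert_eq_span hmem] at h
    omega
  · intro h
    rw [Submodule.span_insert, sup_comm, Submodule.finrank_sup_span_singleton h]

/-- If adding a row raises the rank on a column set, it does so on every larger column set. -/
theorem subRank_insert_eq_add_one_mono {F m n : Type*} [Field F] [Fintype n] [DecidableEq m]
    {A : Matrix m n F} {S : Finset m} {a : m} {C D : Finset n} (hCD : C ⊆ D)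
    (h : subRank A (insert a S) C = subRank A S C + 1) :
    subRank A (insert a S) D = subRank A S D + 1 := by
  rw [subRank_insert_eq_add_one_iff] at h ⊢
  intro hmem
  apply h
  have hmap := Submodule.mem_map_of_mem
    (f := LinearMap.funLeft F F (fun j : C => (⟨j, hCD j.2⟩ : D))) hmem
  rwa [Submodule.map_span, Set.image_image] at hmap

/-- Adding a new row of an invertible matrix raises the rank when all columns are kept. -/
theorem subRank_insert_univ_of_isUnit {F n : Type*} [Field F] [Fintype n] [DecidableEq n]
    {A : Matrix n n F} (hA : IsUnit A) {S : Finset n} {a : n} (ha : a ∉ S) :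
    subRank A (insert a S) Finset.univ = subRank A S Finset.univ + 1 := by
  rw [subRank_insert_eq_add_one_iff]
  intro hmem
  have hrows : LinearIndependent F A.row := Matrix.linearIndependent_rows_iff_isUnit.2 hA
  apply hrows.notMem_span_image (s := (S : Set n)) (x := a) (by simpa using ha)
  have hmap := Submodule.mem_map_of_mem
    (f := LinearMap.funLeft F F (fun j : n => (⟨j, Finset.mem_univ j⟩ : Finset.univ))) hmem
  rwa [Submodule.map_span, Set.image_image] at hmap

/-- **Interval structure of the compression index set under the separability condition**
(Theorem 3's combinatorial content): let `A` be an invertible `L×L` matrix and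
`𝓛 1, …, 𝓛 (2L−1)` column sets (here `0`-indexed, so indices `0, …, 2L−2` with middle index
`L−1`) that are unimodally nested around the middle: `𝓛 (L−1) = univ`, `𝓛 k ⊆ 𝓛 (k+1)`
below the middle, and `𝓛 (k+1) ⊆ 𝓛 k` above. For a row set `S` and a row `a ∉ S`, with
`J := {k < 2L−1 : rank A(S ∪ {a}, 𝓛 k) = rank A(S, 𝓛 k) + 1}`, the middle index `L−1`
belongs to `J`, `J` is closed towards the middle from both sides, and hence `J` is the
integer interval `[min J, max J]`. -/
theorem compression_index_set_is_interval
    {F : Type*} [Field F] {L : ℕ} (hL : 0 < L)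
    (A : Matrix (Fin L) (Fin L) F) (hA : IsUnit A)
    (𝓛 : ℕ → Finset (Fin L))
    (hmid : 𝓛 (L - 1) = Finset.univ)
    (hup : ∀ k, k + 1 < L → 𝓛 k ⊆ 𝓛 (k + 1))
    (hdown : ∀ k, L - 1 ≤ k → k + 1 < 2 * L - 1 → 𝓛 (k + 1) ⊆ 𝓛 k)
    (S : Finset (Fin L)) (a : Fin L) (ha : a ∉ S)
    (J : Finset ℕ)
    (hJdef : J = (Finset.range (2 * L - 1)).filter (fun k =>
      subRank A (insert a S) (𝓛 k) = subRank A S (𝓛 k) + 1)) :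
    (L - 1) ∈ J ∧
      (∀ k ∈ J, ∀ k', k < k' → k' ≤ L - 1 → k' ∈ J) ∧
      (∀ k ∈ J, ∀ k', L - 1 ≤ k' → k' < k → k' ∈ J) ∧
      ∀ hJ : J.Nonempty, J = Finset.Icc (J.min' hJ) (J.max' hJ) := by
  have hmem : ∀ k, k ∈ J ↔ k < 2 * L - 1 ∧
      subRank A (insert a S) (𝓛 k) = subRank A S (𝓛 k) + 1 := by
    simp [hJdef]
  have hLJ : L - 1 ∈ J :=
    (hmem _).2 ⟨by omega, by rw [hmid]; exact subRank_insert_univ_of_isUnit hA ha⟩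
  have hleft : ∀ k ∈ J, ∀ k', k < k' → k' ≤ L - 1 → k' ∈ J := by
    intro k hk k' hkk'
    induction k', hkk'.le using Nat.le_induction with
    | base => omega
    | succ i hi ih =>
      intro hiL
      have hiJ : i ∈ J := by
        rcases hi.eq_or_lt with rfl | hlt
        · exact hk
        · exact ih hlt (by omega)
      exact (hmem _).2 ⟨by omega,
        subRank_insert_eq_add_one_mono (hup i (by omega)) ((hmem _).1 hiJ).2⟩
  have hright : ∀ k ∈ J, ∀ k', L - 1 ≤ k' → k' < k → k' ∈ J := by
    intro k hk k' hLk' hk'k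
    have hkL := ((hmem _).1 hk).1
    have hsub : 𝓛 k ⊆ 𝓛 k' := by
      clear hk
      induction k, hk'k.le using Nat.le_induction with
      | base => omega
      | succ i hi ih =>
        have hstep := hdown i (by omega) (by omega)
        rcases hi.eq_or_lt with rfl | hlt
        · exact hstep
        · exact hstep.trans (ih hlt (by omega))
    exact (hmem _).2 ⟨by omega, subRank_insert_eq_add_one_mono hsub ((hmem _).1 hk).2⟩
  refine ⟨hLJ, hleft, hright, fun hJ => Finset.Subset.antisymm ?_ ?_⟩
  · intro k hk
    exact Finset.mem_Icc.2 ⟨J.min'_le k hk, J.le_max' k hk⟩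
  · intro k hk
    obtain ⟨hmin, hmax⟩ := Finset.mem_Icc.1 hk
    rcases le_total k (L - 1) with h | h
    · rcases hmin.eq_or_lt with heq | hlt
      · exact heq ▸ J.min'_mem hJ
      · exact hleft _ (J.min'_mem hJ) k hlt h
    · rcases hmax.eq_or_lt with heq | hlt
      · exact heq ▸ J.max'_mem hJ
      · exact hright _ (J.max'_mem hJ) k h hlt
end
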